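/- Let A ∈ M_n(ℂ) be such that its first n−1 rows are linearly independent and e_n·e_n = b (e_1·e_1) for some b ∈ ℂ with b ≠ 0. Let d be a derivation of E(A) with matrix entries d_{ij}, and suppose d_{1n} ≠ 0. Then d_{11} ≠ 0. -/

import Mathlib

open Matrix Polynomial Finset

/-- The multiplication of the evolution algebra `E(A)` on `ℂ^n` associated to the
matrix `A`: it is the unique commutative bilinear multiplication with
`e i · e j = 0` for `i ≠ j` and `e i · e i = ∑ k, A i k • e k`, where `e i = Pi.single i 1`
is the standard (natural) basis. -/
noncomputable def evolMul {n : ℕ} (A : Matrix (Fin n) (Fin n) ℂ) (u v : Fin n → ℂ) : Fin n → ℂ :=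
  fun k => ∑ i, u i * v i * A i k

/-- A linear map `d : E(A) → E(A)` is a derivation if `d (u·v) = d u · v + u · d v`. -/
def IsEvolDerivation {n : ℕ} (A : Matrix (Fin n) (Fin n) ℂ)
    (d : (Fin n → ℂ) →ₗ[ℂ] (Fin n → ℂ)) : Prop :=
  ∀ u v : Fin n → ℂ, d (evolMul A u v) = evolMul A (d u) v + evolMul A u (d v)

lemma evolMul_single_right {n : ℕ} (A : Matrix (Fin n) (Fin n) ℂ) (u : Fin n → ℂ) (j : Fin n) :
    evolMul A u (Pi.single j 1) = u j • A j := by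
  funext k
  simp [evolMul, Pi.single_apply]

lemma evolMul_single_left {n : ℕ} (A : Matrix (Fin n) (Fin n) ℂ) (u : Fin n → ℂ) (j : Fin n) :
    evolMul A (Pi.single j 1) u = u j • A j := by
  funext k
  simp [evolMul, Pi.single_apply]

lemma IsEvolDerivation.apply_row {n : ℕ} {A : Matrix (Fin n) (Fin n) ℂ}
    {d : (Fin n → ℂ) →ₗ[ℂ] (Fin n → ℂ)} (hd : IsEvolDerivation A d) (i : Fin n) :
    d (A i) = (2 * d (Pi.single i 1) i) • A i := by
  have h := hd (Pi.single i 1) (Pi.single i 1)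
  rw [evolMul_single_right, evolMul_single_right, evolMul_single_left] at h
  simpa [two_mul, add_smul] using h

lemma IsEvolDerivation.smul_row_add_smul_row {n : ℕ} {A : Matrix (Fin n) (Fin n) ℂ}
    {d : (Fin n → ℂ) →ₗ[ℂ] (Fin n → ℂ)} (hd : IsEvolDerivation A d) {i j : Fin n} (hij : i ≠ j) :
    d (Pi.single i 1) j • A j + d (Pi.single j 1) i • A i = 0 := by
  have h := hd (Pi.single i 1) (Pi.single j 1)
  rw [evolMul_single_right, evolMul_single_right, evolMul_single_left] at h
  simpa [Pi.single_eq_of_ne hij.symm] using h.symm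

lemma LinearMap.pi_apply_eq_sum_single {n : ℕ} (d : (Fin n → ℂ) →ₗ[ℂ] (Fin n → ℂ))
    (v : Fin n → ℂ) (j : Fin n) : d v j = ∑ i, v i * d (Pi.single i 1) j := by
  conv_lhs => rw [pi_eq_sum_univ' v]
  simp [Finset.sum_apply]

/-- If the rows of `A` other than the `l`-th are linearly independent and the `l`-th row is a
nonzero multiple of the `z`-th, then `d z l ≠ 0` forces `d z z ≠ 0` for every derivation `d`. -/
lemma IsEvolDerivation.diag_ne_zero {n : ℕ} {A : Matrix (Fin n) (Fin n) ℂ} {z l : Fin n}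
    (hzl : z ≠ l) (hA : LinearIndependent ℂ (fun i : {i : Fin n // i ≠ l} => A i))
    {b : ℂ} (hb : b ≠ 0) (hl : A l = b • A z)
    {d : (Fin n → ℂ) →ₗ[ℂ] (Fin n → ℂ)} (hd : IsEvolDerivation A d)
    (hdzl : d (Pi.single z 1) l ≠ 0) : d (Pi.single z 1) z ≠ 0 := by
  intro hz
  have hpair : ∀ i j : Fin n, i ≠ l → j ≠ l → i ≠ j → ∀ x y : ℂ,
      x • A i + y • A j = 0 → x = 0 ∧ y = 0 := by
    intro i j hi hj hij
    have h := hA.comp ![⟨i, hi⟩, ⟨j, hj⟩] (by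
      intro p q
      fin_cases p <;> fin_cases q <;> simp [hij, hij.symm])
    refine LinearIndependent.pair_iff.1 ?_
    have he : ((fun i : {i : Fin n // i ≠ l} => A i) ∘ ![⟨i, hi⟩, ⟨j, hj⟩]) = ![A i, A j] := by
      funext p
      fin_cases p <;> rfl
    exact he ▸ h
  have hoff : ∀ i j : Fin n, j ≠ z → j ≠ l → i ≠ j →
      d (Pi.single i 1) j = 0 ∧ d (Pi.single j 1) i = 0 := by
    intro i j hjz hjl hij
    have h := hd.smul_row_add_smul_row hij
    by_cases hil : i = l
    · subst hil
      rw [hl, smul_smul] at h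
      have := hpair j z hjl hzl hjz _ _ h
      exact ⟨this.1, by simpa [hb] using this.2⟩
    · exact hpair j i hjl hil hij.symm _ _ h
  have hne : ∀ i, i ≠ l → A i ≠ 0 := fun i hi => hA.ne_zero ⟨i, hi⟩
  have hdlz : d (Pi.single l 1) z = -(b * d (Pi.single z 1) l) := by
    have h := hd.smul_row_add_smul_row hzl
    rw [hl, smul_smul, ← add_smul] at h
    have := (smul_eq_zero.1 h).resolve_right (hne z hzl)
    linear_combination this
  have hll : d (Pi.single l 1) l = 0 := by
    have h := hd.apply_row l
    rw [hl, map_smul, hd.apply_row z, hz, smul_smul] at h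
    simpa [hb, hne z hzl] using h.symm
  have hker : ∀ v, d v = 0 → ∀ j, (j ≠ l ∧ j ≠ z ∧ d (Pi.single j 1) j = 0) ∨ v j = 0 := by
    intro v hv j
    have hsum : ∀ k, ∑ i, v i * d (Pi.single i 1) k = 0 := fun k => by
      rw [← d.pi_apply_eq_sum_single, hv, Pi.zero_apply]
    by_cases hjl : j = l
    · right
      have h := hsum z
      rw [Finset.sum_eq_single l] at h
      · rw [hjl]
        simpa [hdlz, hb, hdzl] using h
      · intro i _ hi
        by_cases hiz : i = z
        · rw [hiz, hz, mul_zero]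
        · rw [(hoff z i hiz hi (Ne.symm hiz)).2, mul_zero]
      · simp
    by_cases hjz : j = z
    · right
      have h := hsum l
      rw [Finset.sum_eq_single z] at h
      · rw [hjz]
        simpa [hdzl] using h
      · intro i _ hi
        by_cases hil : i = l
        · rw [hil, hll, mul_zero]
        · rw [(hoff l i hi hil (Ne.symm hil)).2, mul_zero]
      · simp
    have h := hsum j
    rw [Finset.sum_eq_single j] at h
    · rcases mul_eq_zero.1 h with h | h
      · exact Or.inr h
      · exact Or.inl ⟨hjl, hjz, h⟩
    · intro i _ hi
      rw [(hoff i j hjz hjl hi).1, mul_zero]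
    · simp
  classical
  let T := {i : Fin n // i ≠ l ∧ d (Pi.single i 1) i = 0}
  let S := {i : Fin n // i ≠ l ∧ i ≠ z ∧ d (Pi.single i 1) i = 0}
  have hcard : Fintype.card S < Fintype.card T :=
    Fintype.card_lt_of_injective_of_notMem (b := (⟨z, hzl, hz⟩ : T))
      (fun i : S => (⟨i.1, i.2.1, i.2.2.2⟩ : T))
      (fun i j h => Subtype.ext (congrArg (fun t : T => t.1) h))
      (by
        rintro ⟨i, hi⟩
        exact i.2.2.1 (congrArg (fun t : T => t.1) hi))
  let f : T → LinearMap.ker d := fun i => ⟨A i.1, by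
    rw [LinearMap.mem_ker, hd.apply_row, i.2.2, mul_zero, zero_smul]⟩
  have hf : LinearIndependent ℂ f := by
    refine LinearIndependent.of_comp (LinearMap.ker d).subtype ?_
    exact hA.comp (fun i : T => (⟨i.1, i.2.1⟩ : {i : Fin n // i ≠ l}))
      (fun i j h => Subtype.ext (congrArg (fun t : {i : Fin n // i ≠ l} => t.1) h))
  let g : LinearMap.ker d →ₗ[ℂ] (S → ℂ) :=
    (LinearMap.funLeft ℂ ℂ (fun i : S => i.1)).comp (LinearMap.ker d).subtype
  have hg : Function.Injective g := by
    refine (injective_iff_map_eq_zero g).2 fun v hv => ?_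
    ext j
    rcases hker v.1 v.2 j with h | h
    · exact congrFun hv ⟨j, h⟩
    · exact h
  have hle := LinearMap.finrank_le_finrank_of_injective hg
  rw [Module.finrank_fintype_fun_eq_card] at hle
  exact absurd (hf.fintype_card_le_finrank.trans hle) hcard.not_ge

/-- Suppose the first `n-1` rows of `A` are linearly independent and
`eₙ·eₙ = b (e₁·e₁)` with `b ≠ 0`.  If a derivation `d` of `E(A)` satisfies `d₁ₙ ≠ 0`,
then `d₁₁ ≠ 0`. -/
theorem derivation_d11_ne_zero_of_d1n_ne_zero (n : ℕ) (hn : 3 ≤ n)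
    (A : Matrix (Fin n) (Fin n) ℂ)
    (hrows : LinearIndependent ℂ (fun i : Fin (n - 1) => A (Fin.castLE (Nat.sub_le n 1) i)))
    (b : ℂ) (hb : b ≠ 0)
    (hlast : evolMul A (Pi.single (⟨n - 1, by omega⟩ : Fin n) 1)
        (Pi.single (⟨n - 1, by omega⟩ : Fin n) 1)
      = b • evolMul A (Pi.single (⟨0, by omega⟩ : Fin n) 1)
          (Pi.single (⟨0, by omega⟩ : Fin n) 1))
    (d : (Fin n → ℂ) →ₗ[ℂ] (Fin n → ℂ)) (hd : IsEvolDerivation A d)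
    (h1n : d (Pi.single (⟨0, by omega⟩ : Fin n) 1) (⟨n - 1, by omega⟩ : Fin n) ≠ 0) :
    d (Pi.single (⟨0, by omega⟩ : Fin n) 1) (⟨0, by omega⟩ : Fin n) ≠ 0 := by
  rw [evolMul_single_right, evolMul_single_right] at hlast
  refine hd.diag_ne_zero ?_ ?_ hb (by simpa using hlast) h1n
  · simp only [ne_eq, Fin.mk.injEq]
    omega
  · have hlt : ∀ i : {i : Fin n // i ≠ ⟨n - 1, by omega⟩}, i.1.1 < n - 1 := by
      rintro ⟨i, hi⟩
      have hval : i.1 ≠ n - 1 := fun h => hi (Fin.ext h)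
      have hlt := i.2
      simp only
      omega
    have hinj : Function.Injective
        (fun i : {i : Fin n // i ≠ ⟨n - 1, by omega⟩} => (⟨i.1.1, hlt i⟩ : Fin (n - 1))) :=
      fun i j h => Subtype.ext (Fin.ext (Fin.mk.inj h))
    exact hrows.comp _ hinj
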